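/- Fix a real number $\lambda$, a nonzero real number $\gamma$ and positive reals $\rho_0, \theta_0, P_0$, and set $G_0 = \gamma P_0/\rho_0$ and $H_0 = \gamma P_0/\theta_0$ (so that $G_0 \neq 0$). Fix vectors $g, n_0, u, u_e, p \in \mathbb{R}^3$ (where $n_0$ represents the gradient of the background potential temperature $\theta_0$, and $p$ the gradient of the pressure, at a point) and reals $\rho, \theta, \theta_e$, and set $P = G_0\rho + H_0\theta$. Define the linear map $\mathcal{A} : \mathbb{R}^3 \to \mathbb{R}^3$ by $\mathcal{A}v = v + (\lambda^2/\theta_0)(n_0\cdot v)\, g$, i.e. $\mathcal{A} = I + \lambda^2 (g/\theta_0) n_0^{\top}$. Assume the potential-temperature equation $\theta = \theta_e - \lambda (u\cdot n_0)$ and the momentum equation $u = u_e - \lambda\left[\frac{1}{\rho_0} p + \frac{\rho}{\rho_0} g\right]$. Then $$\mathcal{A}u = u_e + \lambda \frac{H_0}{G_0\rho_0}\theta_e\, g - \lambda\left[\frac{1}{\rho_0} p + \frac{1}{G_0\rho_0} P\, g\right].$$ Moreover, if $\mathcal{A}$ is invertible, then $u = u_a - u_p$, where $u_a = \mathcal{A}^{-1}\left[u_e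 + \lambda \frac{g}{G_0\rho_0} H_0\theta_e\right]$ and $u_p = \mathcal{A}^{-1}\left[\lambda\left(\frac{1}{\rho_0} p + \frac{g}{G_0\rho_0} P\right)\right]$. -/

import Mathlib

open scoped InnerProductSpace

namespace Set2NC

noncomputable section

/-- Coefficient `G₀ = γ P₀ / ρ₀` of the density in the linearized pressure. -/
def G₀ (γ P₀ ρ₀ : ℝ) : ℝ := γ * P₀ / ρ₀

/-- Coefficient `H₀ = γ P₀ / θ₀` of the potential temperature in the linearized pressure. -/
def H₀ (γ P₀ θ₀ : ℝ) : ℝ := γ * P₀ / θ₀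

/-- The map `𝒜 = I + λ² (g/θ₀) n₀ᵀ`, i.e. `𝒜 v = v + (λ²/θ₀) (n₀ · v) g`. -/
def 𝒜 (lam θ₀ : ℝ) (g n₀ : EuclideanSpace ℝ (Fin 3)) :
    EuclideanSpace ℝ (Fin 3) →L[ℝ] EuclideanSpace ℝ (Fin 3) :=
  ContinuousLinearMap.id ℝ (EuclideanSpace ℝ (Fin 3))
    + (lam ^ 2 / θ₀) • ((innerSL ℝ n₀).smulRight g)

theorem 𝒜_apply (lam θ₀ : ℝ) (g n₀ v : EuclideanSpace ℝ (Fin 3)) :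
    𝒜 lam θ₀ g n₀ v = v + ((lam ^ 2 / θ₀) * ⟪n₀, v⟫_ℝ) • g := by
  simp [𝒜, smul_smul]

end

end Set2NC

/-- Pointwise velocity elimination in the Schur-complement form of an implicit Set2NC solve. The
first conjunct is `𝒜 u = u_e + λ (H₀/(G₀ρ₀)) θ_e g − λ [(1/ρ₀) p + (1/(G₀ρ₀)) P g]`; the second is
`u = u_a − u_p` when `𝒜` is invertible (`Ring.inverse` is then the two-sided inverse). -/
theorem set2nc_schur_velocity_elimination
    (lam γ ρ₀ θ₀ P₀ : ℝ) (hγ : γ ≠ 0) (hρ₀ : 0 < ρ₀) (hθ₀ : 0 < θ₀) (hP₀ : 0 < P₀)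
    (G₀ H₀ : ℝ) (hG₀ : G₀ = Set2NC.G₀ γ P₀ ρ₀) (hH₀ : H₀ = Set2NC.H₀ γ P₀ θ₀)
    (g n₀ u u_e p : EuclideanSpace ℝ (Fin 3))
    (ρ θ θ_e P : ℝ) (hP : P = G₀ * ρ + H₀ * θ)
    (hθ : θ = θ_e - lam * ⟪u, n₀⟫_ℝ)
    (hu : u = u_e - lam • ((1 / ρ₀) • p + (ρ / ρ₀) • g)) :
    Set2NC.𝒜 lam θ₀ g n₀ u
        = u_e + (lam * (H₀ / (G₀ * ρ₀)) * θ_e) • g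
          - lam • ((1 / ρ₀) • p + ((1 / (G₀ * ρ₀)) * P) • g)
    ∧ (IsUnit (Set2NC.𝒜 lam θ₀ g n₀) →
        ∀ u_a u_p : EuclideanSpace ℝ (Fin 3),
          u_a = Ring.inverse (Set2NC.𝒜 lam θ₀ g n₀)
            (u_e + lam • ((H₀ * θ_e) • ((1 / (G₀ * ρ₀)) • g))) →
          u_p = Ring.inverse (Set2NC.𝒜 lam θ₀ g n₀)
            (lam • ((1 / ρ₀) • p + P • ((1 / (G₀ * ρ₀)) • g))) →
          u = u_a - u_p) := by
  have hA : Set2NC.𝒜 lam θ₀ g n₀ u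
      = u_e + (lam * (H₀ / (G₀ * ρ₀)) * θ_e) • g
        - lam • ((1 / ρ₀) • p + ((1 / (G₀ * ρ₀)) * P) • g) := by
    have hcoeff : lam ^ 2 / θ₀ * ⟪n₀, u⟫_ℝ - lam * (ρ / ρ₀)
        = lam * (H₀ / (G₀ * ρ₀)) * θ_e - lam * ((1 / (G₀ * ρ₀)) * P) := by
      rw [hP, hθ, real_inner_comm, hG₀, hH₀, Set2NC.G₀, Set2NC.H₀]
      field_simp
      ring
    rw [Set2NC.𝒜_apply]
    calc u + (lam ^ 2 / θ₀ * ⟪n₀, u⟫_ℝ) • g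
        = u_e - lam • ((1 / ρ₀) • p + (ρ / ρ₀) • g) + (lam ^ 2 / θ₀ * ⟪n₀, u⟫_ℝ) • g :=
          congrArg (· + (lam ^ 2 / θ₀ * ⟪n₀, u⟫_ℝ) • g) hu
      _ = u_e - (lam * (1 / ρ₀)) • p
            + (lam ^ 2 / θ₀ * ⟪n₀, u⟫_ℝ - lam * (ρ / ρ₀)) • g := by module
      _ = _ := by rw [hcoeff]; module
  refine ⟨hA, ?_⟩
  rintro hunit u_a u_p rfl rfl
  have hinv : Ring.inverse (Set2NC.𝒜 lam θ₀ g n₀) (Set2NC.𝒜 lam θ₀ g n₀ u) = u :=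
    DFunLike.congr_fun (Ring.inverse_mul_cancel _ hunit) u
  rw [← map_sub]
  refine hinv.symm.trans (congrArg _ (hA.trans ?_))
  module
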